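/- Let D ⊆ ℂⁿ be a bounded open set, let φ : D → D be a map, and suppose there exists z₀ ∈ D with dist(φ^{(j)}(z₀), ∂D) → 0 as j → ∞. Let k : D → ℝ be a function with k(w) > 0 for all w ∈ D and k(w) → ∞ as w → ∂D, and let ψ : D → ℂ satisfy: there exist ν > 0 and δ > 0 such that |ψ(w)| ≥ ν whenever w ∈ D and dist(w, ∂D) < δ. Then it is NOT the case that |ψ(w)|² · k(φ(w)) / k(w) → 0 as w → ∂D; in fact there exist c > 0 and a sequence (w_m) in D with dist(w_m, ∂D) → 0 and |ψ(w_m)|² k(φ(w_m))/k(w_m) ≥ c for all m. -/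

import Mathlib

open Metric Filter Set

/-- A sequence tending to infinity strictly increases at infinitely many steps. -/
theorem Filter.Tendsto.frequently_lt_succ {α : Type*} [LinearOrder α] [NoMaxOrder α]
    {u : ℕ → α} (hu : Tendsto u atTop atTop) : ∃ᶠ j in atTop, u j < u (j + 1) := by
  intro h
  obtain ⟨N, hN⟩ := eventually_atTop.1 h
  have hle : ∀ j ≥ N, u j ≤ u N := fun j hj =>
    Nat.le_induction le_rfl (fun i hi ih => (not_lt.1 (hN i hi)).trans ih) j hj
  obtain ⟨j, hj, hlt⟩ := ((eventually_ge_atTop N).and (hu.eventually_gt_atTop (u N))).exists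
  exact (hle j hj).not_gt hlt

/-- Let `D ⊆ ℂⁿ` be a bounded open set, let `φ : D → D` be a map, and
suppose there exists `z₀ ∈ D` with `dist(φ^[j] z₀, ∂D) → 0` as `j → ∞`.  Let `k : D → ℝ`
be positive on `D` with `k w → ∞` as `w → ∂D`, and let `ψ : D → ℂ` be bounded away from
zero toward `∂D` (there are `ν > 0`, `δ > 0` with `|ψ w| ≥ ν` whenever `w ∈ D` and
`dist(w, ∂D) < δ`).  Then it is NOT the case that `|ψ w|² · k (φ w) / k w → 0` as
`w → ∂D`; in fact there exist `c > 0` and a sequence `(w_m)` in `D` with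
`dist(w_m, ∂D) → 0` and `|ψ (w_m)|² k (φ (w_m)) / k (w_m) ≥ c` for all `m`. -/
theorem weight_kernel_ratio_not_tendsto_zero_along_orbit
    {n : ℕ} (D : Set (EuclideanSpace ℂ (Fin n)))
    (hD_open : IsOpen D) (hD_bdd : Bornology.IsBounded D)
    (φ : EuclideanSpace ℂ (Fin n) → EuclideanSpace ℂ (Fin n))
    (hφ_maps : Set.MapsTo φ D D)
    (z₀ : EuclideanSpace ℂ (Fin n)) (hz₀ : z₀ ∈ D)
    (horbit : Tendsto (fun j : ℕ => infDist (φ^[j] z₀) (frontier D)) atTop (nhds 0))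
    (k : EuclideanSpace ℂ (Fin n) → ℝ)
    (hk_pos : ∀ w ∈ D, 0 < k w)
    (hk_infty : ∀ M > (0 : ℝ), ∃ δ' > 0, ∀ w ∈ D, infDist w (frontier D) < δ' → M < k w)
    (ψ : EuclideanSpace ℂ (Fin n) → ℂ)
    (hψ_bdd : ∃ ν > (0 : ℝ), ∃ δ > (0 : ℝ), ∀ w ∈ D, infDist w (frontier D) < δ → ν ≤ ‖ψ w‖) :
    (¬ ∀ ε > (0 : ℝ), ∃ δ > (0 : ℝ), ∀ w ∈ D, infDist w (frontier D) < δ →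
        ‖ψ w‖ ^ 2 * k (φ w) / k w < ε) ∧
    ∃ c > (0 : ℝ), ∃ w : ℕ → EuclideanSpace ℂ (Fin n),
      (∀ m, w m ∈ D) ∧
      Tendsto (fun m : ℕ => infDist (w m) (frontier D)) atTop (nhds 0) ∧
      ∀ m, c ≤ ‖ψ (w m)‖ ^ 2 * k (φ (w m)) / k (w m) := by
  have hmem : ∀ j, φ^[j] z₀ ∈ D := fun j => hφ_maps.iterate j hz₀
  obtain ⟨ν, hν, δ, hδ, hψ⟩ := hψ_bdd
  have hk : Tendsto (fun j => k (φ^[j] z₀)) atTop atTop := by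
    refine tendsto_atTop.2 fun M => ?_
    obtain ⟨δ', hδ', hM⟩ := hk_infty (max M 1) (by positivity)
    filter_upwards [horbit.eventually_lt_const hδ'] with j hj
    exact (le_max_left M 1).trans (hM _ (hmem j) hj).le
  have hfreq : ∃ᶠ j in atTop,
      ν ^ 2 ≤ ‖ψ (φ^[j] z₀)‖ ^ 2 * k (φ (φ^[j] z₀)) / k (φ^[j] z₀) := by
    refine (hk.frequently_lt_succ.and_eventually (horbit.eventually_lt_const hδ)).mono ?_
    rintro j ⟨hlt, hj⟩
    rw [Function.iterate_succ_apply'] at hlt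
    have hψj := hψ _ (hmem j) hj
    rw [le_div_iff₀ (hk_pos _ (hmem j))]
    have := (hk_pos _ (hmem j)).le
    gcongr
  obtain ⟨s, hs, hsν⟩ := extraction_of_frequently_atTop hfreq
  have hlim := horbit.comp hs.tendsto_atTop
  refine ⟨fun h => ?_, ν ^ 2, by positivity, fun m => φ^[s m] z₀, fun m => hmem _, hlim, hsν⟩
  obtain ⟨η, hη, hsmall⟩ := h (ν ^ 2) (by positivity)
  obtain ⟨m, hm⟩ := (hlim.eventually_lt_const hη).exists
  exact (hsν m).not_gt (hsmall _ (hmem _) hm)
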